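/- (Proposition, divergence of the scaled denoiser.) Let ι be a finite index set, let d : ι → ℝ be amplitudes, let τ > 0 be a noise scale, and let q : ι → ℝ be fixed priors with 0 ≤ q i ≤ 1 for every i ∈ ι, not depending on the observation vector. Define η : (ι → ℝ) → (ι → ℝ) componentwise by η(r)(i) = ŝ(q i, r i, τ; d i). Then for every r : ι → ℝ, the divergence of the map r ↦ (i ↦ d i · η(r)(i)), namely the sum over i ∈ ι of the partial derivative of d i · η(r)(i) with respect to the coordinate r i, equals (1/τ²)·( Σ_{i∈ι} (d i)²·η(r)(i) − Σ_{i∈ι} (d i · η(r)(i))² ). -/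

import Mathlib

/-- The posterior mean estimator (PME). -/
noncomputable def pme (d τ q r : ℝ) : ℝ :=
  q * Real.exp (-(r - d)^2 / (2 * τ^2)) /
    (q * Real.exp (-(r - d)^2 / (2 * τ^2)) + (1 - q) * Real.exp (-r^2 / (2 * τ^2)))

theorem pme_denom_pos (d τ : ℝ) {q : ℝ} (hq₀ : 0 ≤ q) (hq₁ : q ≤ 1) (r : ℝ) :
    0 < q * Real.exp (-(r - d)^2 / (2 * τ^2)) + (1 - q) * Real.exp (-r^2 / (2 * τ^2)) := by
  rcases hq₀.eq_or_lt with rfl | hq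
  · simpa using Real.exp_pos _
  · have : 0 ≤ 1 - q := sub_nonneg.2 hq₁
    positivity

theorem hasDerivAt_exp_neg_sq_div (a r : ℝ) {τ : ℝ} (hτ : τ ≠ 0) :
    HasDerivAt (fun t : ℝ => Real.exp (-(t - a)^2 / (2 * τ^2)))
      (Real.exp (-(r - a)^2 / (2 * τ^2)) * (-(r - a) / τ^2)) r := by
  have h := (((((hasDerivAt_id r).sub_const a).pow 2).neg).div_const (2 * τ^2)).exp
  refine h.congr_deriv ?_
  simp
  field_simp
  ring

/-- The posterior mean estimator satisfies the logistic equation `p' = (d / τ²) p (1 - p)`. -/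
theorem hasDerivAt_pme (d r : ℝ) {τ q : ℝ} (hτ : τ ≠ 0) (hq₀ : 0 ≤ q) (hq₁ : q ≤ 1) :
    HasDerivAt (pme d τ q) (d / τ^2 * (pme d τ q r * (1 - pme d τ q r))) r := by
  have hD := (pme_denom_pos d τ hq₀ hq₁ r).ne'
  have hA := (hasDerivAt_exp_neg_sq_div d r hτ).const_mul q
  have hB : HasDerivAt (fun t : ℝ => (1 - q) * Real.exp (-t^2 / (2 * τ^2)))
      ((1 - q) * (Real.exp (-r^2 / (2 * τ^2)) * (-r / τ^2))) r := by
    simpa only [sub_zero] using (hasDerivAt_exp_neg_sq_div 0 r hτ).const_mul (1 - q)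
  refine (hA.div (hA.add hB) hD).congr_deriv ?_
  simp only [pme, Pi.add_apply]
  generalize Real.exp (-(r - d)^2 / (2 * τ^2)) = A at *
  generalize Real.exp (-r^2 / (2 * τ^2)) = B at *
  field_simp
  ring

/-- Divergence of the scaled denoiser: with `η(r)(i) = ŝ(q i, r i, τ; d i)`, the
divergence of `r ↦ (i ↦ d i · η(r)(i))`, i.e. the sum over `i` of the partial derivative
of `d i · η(r)(i)` with respect to the coordinate `r i`, equals
`(1/τ²)·( Σᵢ (d i)²·η(r)(i) − Σᵢ (d i · η(r)(i))² )`. -/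
theorem divergence_scaled_denoiser {ι : Type*} [Fintype ι] [DecidableEq ι]
    (d q : ι → ℝ) (τ : ℝ) (hτ : 0 < τ) (hq : ∀ i, 0 ≤ q i ∧ q i ≤ 1) (r : ι → ℝ) :
    (∑ i : ι,
        deriv (fun t : ℝ =>
          d i * pme (d i) τ (q i) ((Function.update r i t) i)) (r i)) =
      (1 / τ^2) *
        ((∑ i : ι, (d i)^2 * pme (d i) τ (q i) (r i)) -
          ∑ i : ι, (d i * pme (d i) τ (q i) (r i))^2) := by
  have hderiv (i : ι) :
      deriv (fun t : ℝ => d i * pme (d i) τ (q i) ((Function.update r i t) i)) (r i) =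
        d i * (d i / τ^2 * (pme (d i) τ (q i) (r i) * (1 - pme (d i) τ (q i) (r i)))) := by
    simp only [Function.update_self]
    exact ((hasDerivAt_pme (d i) (r i) hτ.ne' (hq i).1 (hq i).2).const_mul (d i)).deriv
  rw [← Finset.sum_sub_distrib, Finset.mul_sum]
  refine Finset.sum_congr rfl fun i _ => ?_
  rw [hderiv]
  ring
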